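/- Let α ∈ (−1,0) and let j = (j₁,j₂) with real numbers 0 < j₂ < j₁. Then ∫_{tr(j₁,j₂)} ‖x‖^{2α} dx = (j₂^{2α+2} + j₁^{2α+2})/(2^{3/2}(α+1)) · ₂F₁(1/2, 3/2+α; 3/2; 1/2) − (j₁ · j₂^{2α+2})/(2‖j‖(α+1)) · ₂F₁(1/2, 3/2+α; 3/2; j₁²/‖j‖²) − (j₁^{2α+2} · j₂)/(2‖j‖(α+1)) · ₂F₁(1/2, 3/2+α; 3/2; j₂²/‖j‖²). -/

import Mathlib

open MeasureTheory Filter Set Real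

noncomputable section

abbrev E2 : Type := EuclideanSpace ℝ (Fin 2)

/-- The triangle `tr(a,b) = {(x₁,x₂) : b ≤ x₁ ≤ a, b ≤ x₂ ≤ x₁}`. -/
def tri (a b : ℝ) : Set E2 :=
  {x : E2 | b ≤ x 0 ∧ x 0 ≤ a ∧ b ≤ x 1 ∧ x 1 ≤ x 0}

/-- The Gauss hypergeometric function `₂F₁(a,b;c;z) = Σₖ (a)ₖ(b)ₖ/(c)ₖ · zᵏ/k!`,
where `(q)ₖ` is the (ascending) Pochhammer symbol. -/
def hyp2F1 (a b c z : ℝ) : ℝ :=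
  ∑' k : ℕ, ((ascPochhammer ℝ k).eval a * (ascPochhammer ℝ k).eval b /
    (ascPochhammer ℝ k).eval c) * z ^ k / (k.factorial : ℝ)

/-- The odd function `s ↦ s · ₂F₁(1/2, b; 3/2; s²)`, a primitive of `s ↦ (1 - s²)⁻ᵇ`. -/
def oddPrimitive (b s : ℝ) : ℝ := s * hyp2F1 (1 / 2) b (3 / 2) (s ^ 2)

lemma ascPochhammer_eval_half_div (k : ℕ) :
    (ascPochhammer ℝ k).eval (1 / 2) / (ascPochhammer ℝ k).eval (3 / 2) = 1 / (2 * k + 1) := by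
  induction k with
  | zero => simp
  | succ k ih =>
    have h : 0 < (ascPochhammer ℝ k).eval (3 / 2) := ascPochhammer_pos k _ (by norm_num)
    rw [ascPochhammer_succ_eval, ascPochhammer_succ_eval, mul_div_mul_comm, ih]
    push_cast
    field_simp
    ring

lemma hasSum_ascPochhammer_one_sub_rpow (b : ℝ) {x : ℝ} (hx : |x| < 1) :
    HasSum (fun k : ℕ ↦ (ascPochhammer ℝ k).eval b / k.factorial * x ^ k) ((1 - x) ^ (-b)) := by
  have h := (one_div_one_sub_rpow_hasFPowerSeriesOnBall_zero b).hasSum (y := x)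
    (by simpa [enorm_eq_nnnorm] using! hx)
  have hx' : 0 ≤ 1 - x := by linarith [le_abs_self x]
  simp only [zero_add, FormalMultilinearSeries.ofScalars_apply_eq, ← Ring.multichoose_eq,
    smul_eq_mul] at h
  rw [Real.rpow_neg hx', ← one_div]
  have hcoeff (k : ℕ) : (ascPochhammer ℝ k).eval b / k.factorial = Ring.multichoose b k := by
    rw [div_eq_iff (by positivity), ← Polynomial.ascPochhammer_smeval_eq_eval,
      ← Ring.factorial_nsmul_multichoose_eq_ascPochhammer, nsmul_eq_mul, mul_comm]
  simpa only [hcoeff] using h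

lemma hasDerivAt_oddPrimitive (b : ℝ) {s : ℝ} (hs : |s| < 1) :
    HasDerivAt (oddPrimitive b) ((1 - s ^ 2) ^ (-b)) s := by
  obtain ⟨r, hsr, hr1⟩ := exists_between hs
  have hr0 : 0 < r := (abs_nonneg s).trans_lt hsr
  have sq_lt {t : ℝ} (ht : |t| < 1) : |t ^ 2| < 1 := by
    rw [abs_pow]
    exact pow_lt_one₀ (abs_nonneg t) ht two_ne_zero
  set c : ℕ → ℝ := fun k ↦ (ascPochhammer ℝ k).eval b / k.factorial with hc
  have hfun : oddPrimitive b = fun t ↦ ∑' k : ℕ, c k * t ^ (2 * k + 1) / (2 * k + 1) := by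
    ext t
    rw [oddPrimitive, hyp2F1, ← tsum_mul_left]
    congr 1 with k
    rw [mul_div_right_comm (Polynomial.eval _ _), ascPochhammer_eval_half_div, hc]
    ring
  have hu : Summable fun k ↦ |c k * (r ^ 2) ^ k| :=
    (hasSum_ascPochhammer_one_sub_rpow b
      (sq_lt (by rwa [abs_of_pos hr0]))).summable.abs
  have hd : HasDerivAt (oddPrimitive b) (∑' k : ℕ, c k * (s ^ 2) ^ k) s := by
    rw [hfun]
    refine hasDerivAt_tsum_of_isPreconnected (t := Ioo (-r) r) (y₀ := 0) hu isOpen_Ioo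
      isPreconnected_Ioo (g := fun k t ↦ c k * t ^ (2 * k + 1) / (2 * k + 1))
      (g' := fun k t ↦ c k * (t ^ 2) ^ k) (fun k t _ ↦ ?_) (fun k t ht ↦ ?_)
      ⟨by linarith, hr0⟩ (by simp) (abs_lt.mp hsr)
    · convert! (((hasDerivAt_pow (2 * k + 1) t).const_mul (c k)).div_const (2 * k + 1 : ℝ)) using 1
      push_cast
      rw [← pow_mul]
      field_simp
    · rw [Real.norm_eq_abs, abs_mul, abs_mul, abs_pow, abs_pow, abs_pow, abs_pow]
      have : |t| ≤ |r| := (abs_lt.mpr ht).le.trans (le_abs_self r)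
      gcongr
  rwa [(hasSum_ascPochhammer_one_sub_rpow b (sq_lt hs)).tsum_eq] at hd

lemma sq_div_rpow_neg (α : ℝ) {x q : ℝ} (hx : 0 < x) (hq : 0 < q) :
    (x ^ 2 / q) ^ (-(3 / 2 + α)) = q ^ α * q * √q / (x ^ (2 * α) * x ^ 3) := by
  have h1 : (x ^ 2) ^ (3 / 2 + α) = x ^ (2 * α) * x ^ 3 := by
    rw [← Real.rpow_natCast x 2, ← Real.rpow_natCast x 3, ← Real.rpow_mul hx.le,
      ← Real.rpow_add hx]
    norm_num
    ring_nf
  have h2 : q ^ (3 / 2 + α) = q ^ α * q * √q := by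
    rw [show (3 / 2 + α : ℝ) = α + 1 + 1 / 2 by ring, Real.rpow_add hq, Real.rpow_add hq,
      Real.rpow_one, Real.sqrt_eq_rpow]
  rw [Real.rpow_neg (by positivity), ← Real.inv_rpow (by positivity), inv_div,
    Real.div_rpow hq.le (by positivity), h1, h2]

lemma abs_div_sqrt_add_sq_lt_one {x : ℝ} (y : ℝ) (hx : x ≠ 0) : |y / √(x ^ 2 + y ^ 2)| < 1 := by
  rw [abs_div, abs_of_nonneg (Real.sqrt_nonneg _), div_lt_one (by positivity), ← Real.sqrt_sq_eq_abs]
  exact Real.sqrt_lt_sqrt (sq_nonneg y) (by linarith [pow_pos (abs_pos.mpr hx) 2, sq_abs x])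

lemma hasDerivAt_sqrt_sq_add_sq {x : ℝ} (y : ℝ) (hx : x ≠ 0) :
    HasDerivAt (fun t ↦ √(t ^ 2 + y ^ 2)) (x / √(x ^ 2 + y ^ 2)) x := by
  have hq : x ^ 2 + y ^ 2 ≠ 0 := by positivity
  convert! ((hasDerivAt_pow 2 x).add_const (y ^ 2)).sqrt hq using 1
  simp
  field_simp

lemma hasDerivAt_oddPrimitive_div_sqrt (α : ℝ) {x y : ℝ} (hx : 0 < x) (hy : 0 < y) :
    HasDerivAt (fun t ↦ oddPrimitive (3 / 2 + α) (t / √(x ^ 2 + t ^ 2)))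
      ((x ^ 2 + y ^ 2) ^ α / (x ^ (2 * α) * x)) y := by
  have hq : 0 < x ^ 2 + y ^ 2 := by positivity
  have hr : 0 < √(x ^ 2 + y ^ 2) := by positivity
  have hsq : √(x ^ 2 + y ^ 2) ^ 2 = x ^ 2 + y ^ 2 := Real.sq_sqrt hq.le
  have h1 := hasDerivAt_sqrt_sq_add_sq x hy.ne'
  simp only [add_comm _ (x ^ 2)] at h1
  have h2 := (hasDerivAt_id y).div h1 hr.ne'
  convert! (hasDerivAt_oddPrimitive (3 / 2 + α) (abs_div_sqrt_add_sq_lt_one y hx.ne')).comp y h2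
    using 1
  have h3 : 1 - (y / √(x ^ 2 + y ^ 2)) ^ 2 = x ^ 2 / (x ^ 2 + y ^ 2) := by
    rw [div_pow, hsq]
    field_simp
    ring
  rw [h3, sq_div_rpow_neg α hx hq]
  simp only [id]
  rw [hsq]
  field_simp
  rw [hsq]
  ring

lemma hasDerivAt_oddPrimitive_const_div_sqrt (α : ℝ) {x y : ℝ} (hx : 0 < x) (hy : 0 < y) :
    HasDerivAt (fun t ↦ oddPrimitive (3 / 2 + α) (y / √(t ^ 2 + y ^ 2)))
      (-(y * (x ^ 2 + y ^ 2) ^ α / (x ^ (2 * α) * x ^ 2))) x := by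
  have hq : 0 < x ^ 2 + y ^ 2 := by positivity
  have hr : 0 < √(x ^ 2 + y ^ 2) := by positivity
  have hsq : √(x ^ 2 + y ^ 2) ^ 2 = x ^ 2 + y ^ 2 := Real.sq_sqrt hq.le
  have h2 := (hasDerivAt_const x y).div (hasDerivAt_sqrt_sq_add_sq y hx.ne') hr.ne'
  convert! (hasDerivAt_oddPrimitive (3 / 2 + α) (abs_div_sqrt_add_sq_lt_one y hx.ne')).comp x h2
    using 1
  have h3 : 1 - (y / √(x ^ 2 + y ^ 2)) ^ 2 = x ^ 2 / (x ^ 2 + y ^ 2) := by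
    rw [div_pow, hsq]
    field_simp
    ring
  rw [h3, sq_div_rpow_neg α hx hq]
  rw [hsq]
  field_simp
  ring

lemma div_sqrt_two_mul_sq {x : ℝ} (hx : 0 < x) : x / √(x ^ 2 + x ^ 2) = 1 / √2 := by
  rw [← two_mul, Real.sqrt_mul zero_le_two, Real.sqrt_sq hx.le]
  field_simp

lemma integral_add_sq_rpow (α : ℝ) {x b : ℝ} (hb : 0 < b) (hbx : b ≤ x) :
    ∫ y in b..x, (x ^ 2 + y ^ 2) ^ α =
      x ^ (2 * α) * x * (oddPrimitive (3 / 2 + α) (1 / √2) -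
        oddPrimitive (3 / 2 + α) (b / √(x ^ 2 + b ^ 2))) := by
  have hx : 0 < x := hb.trans_le hbx
  have hpos : ∀ y ∈ uIcc b x, 0 < y := fun y hy ↦ by
    rw [uIcc_of_le hbx] at hy
    exact hb.trans_le hy.1
  rw [intervalIntegral.integral_eq_sub_of_hasDerivAt (f := fun t ↦ x ^ (2 * α) * x *
    oddPrimitive (3 / 2 + α) (t / √(x ^ 2 + t ^ 2))), div_sqrt_two_mul_sq hx]
  · ring
  · intro y hy
    convert! (hasDerivAt_oddPrimitive_div_sqrt α hx (hpos y hy)).const_mul (x ^ (2 * α) * x) using 1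
    field_simp
  · refine Continuous.intervalIntegrable (Continuous.rpow_const (by fun_prop) fun y ↦ ?_) _ _
    exact Or.inl (by positivity)

lemma integral_integral_add_sq_rpow {α a b : ℝ} (hα : -1 < α) (hb : 0 < b) (hab : b ≤ a) :
    ∫ x in b..a, ∫ y in b..x, (x ^ 2 + y ^ 2) ^ α =
      ((b ^ (2 * α + 2) + a ^ (2 * α + 2)) * oddPrimitive (3 / 2 + α) (1 / √2) -
        b ^ (2 * α + 2) * oddPrimitive (3 / 2 + α) (a / √(a ^ 2 + b ^ 2)) -
        a ^ (2 * α + 2) * oddPrimitive (3 / 2 + α) (b / √(a ^ 2 + b ^ 2))) / (2 * α + 2) := by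
  have hα1 : α + 1 ≠ 0 := by linarith
  have hpow {x : ℝ} (hx : 0 < x) : x ^ (2 * α + 2) = x ^ (2 * α) * x ^ 2 := by
    rw [Real.rpow_add hx, Real.rpow_two]
  have hmem : ∀ x ∈ uIcc b a, b ≤ x := fun x hx ↦ by
    rw [uIcc_of_le hab] at hx
    exact hx.1
  rw [intervalIntegral.integral_congr (fun x hx ↦ integral_add_sq_rpow α hb (hmem x hx)),
    intervalIntegral.integral_eq_sub_of_hasDerivAt (f := fun x ↦
      ((b ^ (2 * α + 2) + x ^ (2 * α + 2)) * oddPrimitive (3 / 2 + α) (1 / √2) -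
        b ^ (2 * α + 2) * oddPrimitive (3 / 2 + α) (x / √(x ^ 2 + b ^ 2)) -
        x ^ (2 * α + 2) * oddPrimitive (3 / 2 + α) (b / √(x ^ 2 + b ^ 2))) / (2 * α + 2)),
    div_sqrt_two_mul_sq hb]
  · ring
  · intro x hx
    have hx0 : 0 < x := hb.trans_le (hmem x hx)
    have h1 := hasDerivAt_oddPrimitive_div_sqrt α hb hx0
    simp only [add_comm (b ^ 2)] at h1
    have h2 := hasDerivAt_oddPrimitive_const_div_sqrt α hx0 hb
    have h3 := Real.hasDerivAt_rpow_const (p := 2 * α + 2) (Or.inl hx0.ne')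
    convert! ((((h3.const_add (b ^ (2 * α + 2))).mul_const _).sub
      (h1.const_mul (b ^ (2 * α + 2)))).sub (h3.mul h2)).div_const (2 * α + 2) using 1
    rw [hpow hx0, hpow hb, show 2 * α + 2 - 1 = 2 * α + 1 by ring, Real.rpow_add hx0,
      Real.rpow_one]
    field_simp
    ring
  · refine ContinuousOn.intervalIntegrable fun x hx ↦ ContinuousAt.continuousWithinAt ?_
    have hx0 : 0 < x := hb.trans_le (hmem x hx)
    exact ((Real.continuousAt_rpow_const _ _ (Or.inl hx0.ne')).mul continuousAt_id).mul
      (continuousAt_const.sub (hasDerivAt_oddPrimitive_const_div_sqrt α hx0 hb).continuousAt)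

lemma setIntegral_tri (f : ℝ → ℝ → ℝ) {a b : ℝ} (hab : b ≤ a)
    (hf : IntegrableOn (fun p : ℝ × ℝ ↦ f p.1 p.2) (Icc b a ×ˢ Icc b a)) :
    ∫ x in tri a b, f (x 0) (x 1) = ∫ x in b..a, ∫ y in b..x, f x y := by
  set T : Set (ℝ × ℝ) := {p | b ≤ p.1 ∧ p.1 ≤ a ∧ b ≤ p.2 ∧ p.2 ≤ p.1} with hT
  have hTm : MeasurableSet T := by
    apply IsClosed.measurableSet
    rw [hT]
    simp only [ofPred_and]
    exact (isClosed_le (by fun_prop) (by fun_prop)).inter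
      ((isClosed_le (by fun_prop) (by fun_prop)).inter
      ((isClosed_le (by fun_prop) (by fun_prop)).inter
      (isClosed_le (by fun_prop) (by fun_prop))))
  have hmp := (volume_preserving_finTwoArrow ℝ).comp
    (EuclideanSpace.volume_preserving_symm_measurableEquiv_toLp (Fin 2))
  have hemb : MeasurableEmbedding (MeasurableEquiv.finTwoArrow (α := ℝ) ∘
      (MeasurableEquiv.toLp 2 (Fin 2 → ℝ)).symm) :=
    MeasurableEquiv.finTwoArrow.measurableEmbedding.comp (MeasurableEquiv.measurableEmbedding _)
  have h1 : ∫ x in tri a b, f (x 0) (x 1) = ∫ p in T, f p.1 p.2 :=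
    hmp.setIntegral_preimage_emb hemb (fun p ↦ f p.1 p.2) T
  have hTsub : T ⊆ Icc b a ×ˢ Icc b a := fun p hp ↦
    ⟨⟨hp.1, hp.2.1⟩, hp.2.2.1, hp.2.2.2.trans hp.2.1⟩
  rw [h1, ← integral_indicator hTm, Measure.volume_eq_prod,
    integral_prod _ ((hf.mono_set hTsub).integrable_indicator hTm),
    intervalIntegral.integral_of_le hab, ← integral_Icc_eq_integral_Ioc,
    ← integral_indicator measurableSet_Icc]
  congr 1 with x
  by_cases hx : x ∈ Icc b a
  · rw [indicator_of_mem hx, intervalIntegral.integral_of_le hx.1, ← integral_Icc_eq_integral_Ioc,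
      ← integral_indicator measurableSet_Icc]
    congr 1 with y
    simp [indicator_apply, hT, hx.1, hx.2]
  · rw [indicator_of_notMem hx]
    refine integral_eq_zero_of_ae (.of_forall fun y ↦ indicator_of_notMem ?_ _)
    exact fun h ↦ hx ⟨h.1, h.2.1⟩

theorem stmt15 (α : ℝ) (hα : α ∈ Set.Ioo (-1 : ℝ) 0)
    (j₁ j₂ : ℝ) (hj₂ : 0 < j₂) (hj : j₂ < j₁) :
    (∫ x in tri j₁ j₂, ‖x‖ ^ (2 * α)) =
      (j₂ ^ (2 * α + 2) + j₁ ^ (2 * α + 2)) / (2 ^ (3 / 2 : ℝ) * (α + 1)) *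
          hyp2F1 (1 / 2) (3 / 2 + α) (3 / 2) (1 / 2)
      - (j₁ * j₂ ^ (2 * α + 2)) / (2 * Real.sqrt (j₁ ^ 2 + j₂ ^ 2) * (α + 1)) *
          hyp2F1 (1 / 2) (3 / 2 + α) (3 / 2) (j₁ ^ 2 / (j₁ ^ 2 + j₂ ^ 2))
      - (j₁ ^ (2 * α + 2) * j₂) / (2 * Real.sqrt (j₁ ^ 2 + j₂ ^ 2) * (α + 1)) *
          hyp2F1 (1 / 2) (3 / 2 + α) (3 / 2) (j₂ ^ 2 / (j₁ ^ 2 + j₂ ^ 2)) := by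
  have hnorm (x : E2) : ‖x‖ ^ (2 * α) = (x 0 ^ 2 + x 1 ^ 2) ^ α := by
    rw [EuclideanSpace.norm_eq, Real.sqrt_eq_rpow, ← Real.rpow_mul (by positivity)]
    simp
  have hint : IntegrableOn (fun p : ℝ × ℝ ↦ (p.1 ^ 2 + p.2 ^ 2) ^ α)
      (Icc j₂ j₁ ×ˢ Icc j₂ j₁) := by
    refine ContinuousOn.integrableOn_compact (isCompact_Icc.prod isCompact_Icc) ?_
    refine ContinuousOn.rpow_const (by fun_prop) fun p hp ↦ Or.inl ?_
    have : 0 < p.1 := hj₂.trans_le hp.1.1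
    positivity
  have h2 : (2 : ℝ) ^ (3 / 2 : ℝ) = 2 * √2 := by
    rw [show (3 / 2 : ℝ) = 1 + 1 / 2 by norm_num, Real.rpow_add two_pos, Real.rpow_one,
      Real.sqrt_eq_rpow]
  simp only [hnorm]
  rw [setIntegral_tri (fun x y ↦ (x ^ 2 + y ^ 2) ^ α) hj.le hint,
    integral_integral_add_sq_rpow hα.1 hj₂ hj.le, h2]
  simp only [oddPrimitive, div_pow, Real.sq_sqrt zero_le_two,
    Real.sq_sqrt (add_nonneg (sq_nonneg j₁) (sq_nonneg j₂)), one_pow]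
  rw [show 2 * α + 2 = 2 * (α + 1) by ring]
  field_simp
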